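/- Let q ≥ 1 be an integer and let φ₁*, φ₂* be as in the context. Then for all real numbers a₁, a₂, one has ‖a₁φ₁*‖² + ‖a₂φ₂*‖² ≤ ((q+1)/q)·‖a₁φ₁* + a₂φ₂*‖², where ‖f‖² = ∫₀¹ f(x)² dx. -/

import Mathlib

open Polynomial

/-- The Jacobi-type polynomial sequence: G 1 = 1, G 2 = X - 1/2, and for k ≥ 3,
    G k = (X - 1/2)·G (k-1) - ((k-2)(k+2)/(4(2k-1)(2k+1)))·G (k-2). -/
noncomputable def G : ℕ → Polynomial ℝ
  | 0 => 0
  | 1 => 1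
  | 2 => Polynomial.X - Polynomial.C (1/2)
  | (k+3) =>
      (Polynomial.X - Polynomial.C (1/2)) * G (k+2)
        - Polynomial.C ((((k:ℝ)+1)*((k:ℝ)+5))/(4*(2*(k:ℝ)+5)*(2*(k:ℝ)+7))) * G (k+1)

/-- ψ_k = ((2k+2)!/((k−1)!·(k+1)!))·X(1−X)·G_k. -/
noncomputable def psi (k : ℕ) : Polynomial ℝ :=
  Polynomial.C ((Nat.factorial (2*k+2) : ℝ) /
      ((Nat.factorial (k-1) : ℝ) * (Nat.factorial (k+1) : ℝ)))
    * (Polynomial.X * (1 - Polynomial.X)) * G k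

/-- φ₁* = X − ∑_{k=1}^{q−1} ((2k+3)/(k(k+1)(k+2)(k+3)))·ψ_k. -/
noncomputable def phiStar1 (q : ℕ) : Polynomial ℝ :=
  Polynomial.X - ∑ k ∈ Finset.Icc 1 (q-1),
    Polynomial.C ((2*(k:ℝ)+3)/((k:ℝ)*((k:ℝ)+1)*((k:ℝ)+2)*((k:ℝ)+3))) * psi k

/-- φ₂* = (1−X) − ∑_{k=1}^{q−1} ((−1)^{k−1}(2k+3)/(k(k+1)(k+2)(k+3)))·ψ_k. -/
noncomputable def phiStar2 (q : ℕ) : Polynomial ℝ :=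
  (1 - Polynomial.X) - ∑ k ∈ Finset.Icc 1 (q-1),
    Polynomial.C ((-1:ℝ)^(k-1) * (2*(k:ℝ)+3)/((k:ℝ)*((k:ℝ)+1)*((k:ℝ)+2)*((k:ℝ)+3))) * psi k

/-- Integration over the unit interval as a linear functional on polynomials. -/
noncomputable def II : Polynomial ℝ →ₗ[ℝ] ℝ where
  toFun p := ∫ x in (0:ℝ)..1, p.eval x
  map_add' p r := by
    simp only [eval_add]
    exact intervalIntegral.integral_add (p.continuous.intervalIntegrable _ _)
      (r.continuous.intervalIntegrable _ _)
  map_smul' c p := by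
    simp

lemma II_def (p : Polynomial ℝ) : II p = ∫ x in (0:ℝ)..1, p.eval x := rfl

lemma II_C_mul (c : ℝ) (p : Polynomial ℝ) : II (C c * p) = c * II p := by
  rw [← smul_eq_C_mul, map_smul, smul_eq_mul]

lemma II_X_pow (m : ℕ) : II (X ^ m) = 1 / ((m:ℝ) + 1) := by
  rw [II_def]; simp

lemma II_flip (p : Polynomial ℝ) : II (p.comp (1 - X)) = II p := by
  rw [II_def, II_def]
  have := intervalIntegral.integral_comp_sub_left (a := 0) (b := 1) (fun x => p.eval x) (1:ℝ)
  simpa [eval_comp] using this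

noncomputable def bb (k : ℕ) : ℝ := (((k:ℝ)+1)*((k:ℝ)+5))/(4*(2*(k:ℝ)+5)*(2*(k:ℝ)+7))

lemma G_one : G 1 = 1 := by simp [G]
lemma G_two : G 2 = X - C (1/2) := by simp [G]
lemma G_rec (k : ℕ) : G (k+3) = (X - C (1/2)) * G (k+2) - C (bb k) * G (k+1) := by
  rw [G]; rfl

noncomputable def RR : ℕ → ℝ → ℝ
  | 0, m => 2 / ((m+2)*(m+3)*(m+4))
  | (n+1), m => RR n m * ((m-1-n)/(m+5+n)) * (((n:ℝ)+5)/(2*(2*n+5)))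

lemma RR_succ (n : ℕ) (m : ℝ) :
    RR (n+1) m = RR n m * ((m-1-n)/(m+5+n)) * (((n:ℝ)+5)/(2*(2*n+5))) := rfl

lemma RR_shift (m : ℝ) (hm : 0 ≤ m) (n : ℕ) :
    RR (n+1) (m+1) = RR n m * (((n:ℝ)+5)/(2*(2*n+5))) * (m*(m+2)/((m+n+5)*(m+n+6))) := by
  induction n with
  | zero =>
    simp only [RR]
    push_cast
    field_simp
    ring
  | succ n ih =>
    rw [RR_succ (n+1), ih, RR_succ n m]
    push_cast
    have h1 : m + n + 5 ≠ 0 := by positivity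
    have h2 : m + n + 6 ≠ 0 := by positivity
    have h3 : m + 1 + 5 + (n+1) ≠ 0 := by positivity
    have h4 : m + 5 + n ≠ 0 := by positivity
    have h5 : m + (n+1) + 5 ≠ 0 := by positivity
    have h6 : m + (n+1) + 6 ≠ 0 := by positivity
    field_simp
    ring

lemma moment (n : ℕ) : (∀ m : ℕ, II (X^(m+1) * (1-X)^2 * G (n+1)) = RR n m) ∧
    (∀ m : ℕ, II (X^(m+1) * (1-X)^2 * G (n+2)) = RR (n+1) m) := by
  induction n with
  | zero =>
    have h0 : ∀ m : ℕ, II (X^(m+1) * (1-X)^2 * G (0+1)) = RR 0 m := by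
      intro m
      have : (X^(m+1) * (1-X)^2 * G (0+1) : ℝ[X]) = X^(m+1) - C 2 * X^(m+2) + X^(m+3) := by
        rw [zero_add, G_one, show (C 2 : ℝ[X]) = 2 from rfl]; ring
      rw [this, map_add, map_sub, II_C_mul, II_X_pow, II_X_pow, II_X_pow, RR]
      push_cast
      have h1 : (m:ℝ) + 1 + 1 ≠ 0 := by positivity
      have h2 : (m:ℝ) + 2 + 1 ≠ 0 := by positivity
      have h3 : (m:ℝ) + 3 + 1 ≠ 0 := by positivity
      have h1 : (m:ℝ) + 2 ≠ 0 := by positivity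
      have h2 : (m:ℝ) + 3 ≠ 0 := by positivity
      have h3 : (m:ℝ) + 4 ≠ 0 := by positivity
      field_simp
      ring
    refine ⟨h0, fun m => ?_⟩
    have : (X^(m+1) * (1-X)^2 * G (0+2) : ℝ[X]) = X^((m+1)+1) * (1-X)^2 * G (0+1)
        - C (1/2) * (X^(m+1) * (1-X)^2 * G (0+1)) := by
      rw [zero_add, zero_add, G_one, G_two]; ring
    rw [this, map_sub, II_C_mul, h0, h0]
    simp only [RR]
    push_cast
    have h1 : (m:ℝ) + 2 ≠ 0 := by positivity
    have h2 : (m:ℝ) + 3 ≠ 0 := by positivity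
    have h3 : (m:ℝ) + 4 ≠ 0 := by positivity
    have h3 : (m:ℝ) + 5 ≠ 0 := by positivity
    field_simp
    ring
  | succ n ih =>
    refine ⟨ih.2, fun m => ?_⟩
    have : (X^(m+1) * (1-X)^2 * G (n+1+2) : ℝ[X]) = X^((m+1)+1) * (1-X)^2 * G (n+2)
        - C (1/2) * (X^(m+1) * (1-X)^2 * G (n+2)) - C (bb n) * (X^(m+1) * (1-X)^2 * G (n+1)) := by
      rw [show n+1+2 = n+3 from rfl, G_rec]; ring
    rw [this, map_sub, map_sub, II_C_mul, II_C_mul, ih.2, ih.2, ih.1]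
    push_cast
    rw [RR_shift _ (by positivity), RR_succ (n+1), RR_succ n, bb]
    have h1 : (m:ℝ) + n + 5 ≠ 0 := by positivity
    have h2 : (m:ℝ) + n + 6 ≠ 0 := by positivity
    have h4 : (m:ℝ) + 5 + n ≠ 0 := by positivity
    have h5 : (m:ℝ) + 5 + (n+1) ≠ 0 := by positivity
    have h6 : (2:ℝ)*n+5 ≠ 0 := by positivity
    have h7 : (2:ℝ)*n+7 ≠ 0 := by positivity
    have h8 : (2:ℝ)*(n+1)+5 ≠ 0 := by positivity
    push_cast
    field_simp
    ring

lemma RR_one (n : ℕ) : RR (n+1) 1 = 0 := by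
  induction n with
  | zero => simp [RR]
  | succ n ih => rw [RR_succ, ih]; simp

noncomputable def LL (j k : ℕ) : ℝ := II ((X*(1-X))^2 * G (j+1) * G (k+1))

noncomputable def hh : ℕ → ℝ
  | 0 => 1/30
  | (n+1) => bb n * hh n

lemma LL_zero (k : ℕ) : LL 0 k = if k = 0 then hh 0 else 0 := by
  have : LL 0 k = RR k (1:ℕ) := by
    rw [← (moment k).1 1, LL, zero_add, G_one]
    congr 1; ring
  rw [this]
  cases k with
  | zero => norm_num [RR, hh]
  | succ k => rw [Nat.cast_one, RR_one]; simp

lemma LL_one (k : ℕ) : LL 1 (k+1) = LL 0 (k+2) + bb k * LL 0 k := by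
  simp only [LL]
  rw [← II_C_mul, ← map_add]
  congr 1
  rw [show k+2+1 = k+3 from rfl, G_rec, zero_add, G_one, show 1+1=2 from rfl, G_two]
  ring

lemma LL_rec (j k : ℕ) : LL (j+2) (k+1) = LL (j+1) (k+2) + bb k * LL (j+1) k
    - bb j * LL j (k+1) := by
  simp only [LL]
  rw [← II_C_mul, ← II_C_mul, ← map_add, ← map_sub]
  congr 1
  rw [show k+2+1 = k+3 from rfl, show j+2+1 = j+3 from rfl, G_rec, G_rec]
  ring

lemma LL_eq (j : ℕ) : (∀ k, j ≤ k → LL j k = if k = j then hh j else 0) ∧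
    (∀ k, j + 1 ≤ k → LL (j+1) k = if k = j+1 then hh (j+1) else 0) := by
  induction j with
  | zero =>
    refine ⟨fun k _ => LL_zero k, fun k hk => ?_⟩
    obtain ⟨k, rfl⟩ : ∃ l, k = l+1 := ⟨k-1, by omega⟩
    rw [zero_add, LL_one, LL_zero, LL_zero]
    by_cases h : k = 0
    · subst h; simp [hh]
    · simp [h]
  | succ j ih =>
    refine ⟨ih.2, fun k hk => ?_⟩
    obtain ⟨k, rfl⟩ : ∃ l, k = l+1 := ⟨k-1, by omega⟩
    rw [show j+1+1 = j+2 from rfl, LL_rec, ih.2 _ (by omega), ih.2 _ (by omega), ih.1 _ (by omega)]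
    rw [if_neg (by omega), if_neg (show ¬ (k+1 = j) by omega)]
    by_cases h : k = j+1
    · subst h; simp [hh]
    · rw [if_neg h, if_neg (by omega)]; simp

noncomputable def NN (n : ℕ) : ℝ := (Nat.factorial (2*(n+1)+2) : ℝ) /
      ((Nat.factorial (n+1-1) : ℝ) * (Nat.factorial (n+1+1) : ℝ))

lemma psi_eq (n : ℕ) : psi (n+1) = C (NN n) * (X * (1 - X)) * G (n+1) := rfl

lemma NN_zero : NN 0 = 12 := by norm_num [NN, Nat.factorial]

lemma NN_succ (n : ℕ) : NN (n+1) = NN n * (2*(2*n+5)/(n+1)) := by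
  simp only [NN, Nat.add_sub_cancel]
  rw [show 2*(n+1+1)+2 = (2*(n+1)+2)+1+1 by ring, Nat.factorial_succ (_+1), Nat.factorial_succ (2*(n+1)+2),
    Nat.factorial_succ n, Nat.factorial_succ (n+1+1)]
  push_cast
  have h1 : ((n+1+1).factorial : ℝ) ≠ 0 := by positivity
  have h2 : (n.factorial : ℝ) ≠ 0 := by positivity
  field_simp
  ring

lemma norm_eq (n : ℕ) : NN n ^ 2 * hh n = ((n:ℝ)+1)*(n+2)*(n+3)*(n+4)/(2*n+5) := by
  induction n with
  | zero => rw [NN_zero, hh]; norm_num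
  | succ n ih =>
    rw [NN_succ, hh, show (NN n * (2*(2*n+5)/(n+1)))^2 * (bb n * hh n)
      = (NN n ^ 2 * hh n) * ((2*(2*n+5)/(n+1))^2 * bb n) by ring, ih, bb]
    have h6 : (2:ℝ)*n+5 ≠ 0 := by positivity
    have h7 : (2:ℝ)*n+7 ≠ 0 := by positivity
    have h8 : (2:ℝ)*(n+1)+5 ≠ 0 := by positivity
    push_cast
    field_simp
    ring

lemma mean_eq (n : ℕ) : NN n * RR n 0 = (-1)^n := by
  induction n with
  | zero => rw [NN_zero, RR]; norm_num
  | succ n ih =>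
    rw [NN_succ, RR_succ, pow_succ, ← ih]
    have h6 : (2:ℝ)*n+5 ≠ 0 := by positivity
    field_simp
    ring

lemma psi_psi (j k : ℕ) (h : j ≤ k) : II (psi (j+1) * psi (k+1)) =
    if k = j then ((j:ℝ)+1)*(j+2)*(j+3)*(j+4)/(2*j+5) else 0 := by
  have : psi (j+1) * psi (k+1) = C (NN j) * (C (NN k) * ((X*(1-X))^2 * G (j+1) * G (k+1))) := by
    rw [psi_eq, psi_eq]; ring
  rw [this, II_C_mul, II_C_mul]
  change _ * (_ * LL j k) = _
  rw [(LL_eq j).1 k h]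
  by_cases hk : k = j
  · subst hk; simp only [if_true]; rw [← norm_eq]; ring
  · simp [hk]

lemma psi_right (n : ℕ) : II ((1-X) * psi (n+1)) = (-1)^n := by
  have : (1-X) * psi (n+1) = C (NN n) * (X^(0+1)*(1-X)^2 * G (n+1)) := by
    rw [psi_eq]; ring
  rw [this, II_C_mul, (moment n).1 0, Nat.cast_zero, mean_eq]

lemma G_flip (n : ℕ) : (G (n+1)).comp (1-X) = (-1)^n * G (n+1) ∧
    (G (n+2)).comp (1-X) = (-1)^(n+1) * G (n+2) := by
  have hc : (C (1/2) : ℝ[X]) + C (1/2) = 1 := by rw [← C_add]; norm_num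
  induction n with
  | zero =>
    refine ⟨by simp [G_one], ?_⟩
    rw [zero_add, G_two]
    simp only [sub_comp, X_comp, C_comp]
    linear_combination -hc
  | succ n ih =>
    refine ⟨ih.2, ?_⟩
    rw [show n+1+2 = n+3 from rfl, G_rec]
    simp only [sub_comp, mul_comp, X_comp, C_comp, ih.1, ih.2]
    linear_combination (-(-1)^(n+1) * G (n+2)) * hc

lemma psi_left (n : ℕ) : II (X * psi (n+1)) = 1 := by
  have : X * psi (n+1) = (C ((-1)^n) * ((1-X) * psi (n+1))).comp (1-X) := by
    have h2 : ((-1:ℝ[X])^n) * (-1)^n = 1 := by rw [← mul_pow]; simp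
    rw [psi_eq]
    simp only [sub_comp, mul_comp, X_comp, C_comp, one_comp, (G_flip n).1]
    simp only [C_pow, C_neg, C_1]
    linear_combination (-(X * (C (NN n) * (X*(1-X)) * G (n+1)))) * h2
  rw [this, II_flip, II_C_mul, psi_right, ← mul_pow]; simp

lemma phi1_succ (n : ℕ) : phiStar1 (n+2) = phiStar1 (n+1) -
    C ((2*(n:ℝ)+5)/(((n:ℝ)+1)*((n:ℝ)+2)*((n:ℝ)+3)*((n:ℝ)+4))) * psi (n+1) := by
  simp only [phiStar1, show n+2-1 = n+1 from rfl, Nat.add_sub_cancel]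
  have e : (2*((n+1:ℕ):ℝ)+3)/(((n+1:ℕ):ℝ)*(((n+1:ℕ):ℝ)+1)*(((n+1:ℕ):ℝ)+2)*(((n+1:ℕ):ℝ)+3))
      = (2*(n:ℝ)+5)/(((n:ℝ)+1)*((n:ℝ)+2)*((n:ℝ)+3)*((n:ℝ)+4)) := by
    push_cast; congr 1 <;> ring
  rw [Finset.sum_Icc_succ_top (by omega), ← sub_sub, e]

lemma phi2_succ (n : ℕ) : phiStar2 (n+2) = phiStar2 (n+1) -
    C ((-1)^n * ((2*(n:ℝ)+5)/(((n:ℝ)+1)*((n:ℝ)+2)*((n:ℝ)+3)*((n:ℝ)+4)))) * psi (n+1) := by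
  simp only [phiStar2, show n+2-1 = n+1 from rfl, Nat.add_sub_cancel]
  have e : (-1:ℝ)^(n+1-1) * (2*((n+1:ℕ):ℝ)+3)
        /(((n+1:ℕ):ℝ)*(((n+1:ℕ):ℝ)+1)*(((n+1:ℕ):ℝ)+2)*(((n+1:ℕ):ℝ)+3))
      = (-1)^n * ((2*(n:ℝ)+5)/(((n:ℝ)+1)*((n:ℝ)+2)*((n:ℝ)+3)*((n:ℝ)+4))) := by
    rw [Nat.add_sub_cancel, mul_div_assoc]
    push_cast; congr 2 <;> ring
  rw [Finset.sum_Icc_succ_top (by omega), ← sub_sub, e]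

lemma phi_psi (n : ℕ) : ∀ k, n ≤ k → II (phiStar1 (n+1) * psi (k+1)) = 1 ∧
    II (phiStar2 (n+1) * psi (k+1)) = (-1)^k := by
  induction n with
  | zero =>
    intro k _
    simp only [phiStar1, phiStar2]
    simp [psi_left, psi_right]
  | succ n ih =>
    intro k hk
    obtain ⟨h1, h2⟩ := ih k (by omega)
    rw [show n+1+1 = n+2 from rfl, phi1_succ, phi2_succ, sub_mul, sub_mul, map_sub, map_sub,
      mul_assoc (C _), mul_assoc (C _), II_C_mul, II_C_mul, psi_psi _ _ (by omega), if_neg (by omega), h1, h2]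
    simp

lemma gram (n : ℕ) : II (phiStar1 (n+1) * phiStar1 (n+1)) = 1/(((n:ℝ)+1)*(n+3)) ∧
    II (phiStar2 (n+1) * phiStar2 (n+1)) = 1/(((n:ℝ)+1)*(n+3)) ∧
    II (phiStar1 (n+1) * phiStar2 (n+1)) = (-1)^n/(((n:ℝ)+1)*(n+2)*(n+3)) := by
  induction n with
  | zero =>
    have e1 : phiStar1 (0+1) = X := by simp [phiStar1]
    have e2 : phiStar2 (0+1) = 1 - X := by simp [phiStar2]
    rw [e1, e2]
    have a0 : II 1 = 1 := by simpa using II_X_pow 0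
    have a1 : II X = 1/2 := by have := II_X_pow 1; norm_num at this ⊢; exact this
    have a2 : II (X^2) = 1/3 := by have := II_X_pow 2; norm_num at this ⊢; exact this
    refine ⟨?_, ?_, ?_⟩
    · rw [← sq, a2]; norm_num
    · rw [show ((1-X)*(1-X) : ℝ[X]) = 1 - X - X + X^2 by ring, map_add, map_sub, map_sub, a0, a1, a2]
      norm_num
    · rw [show (X*(1-X) : ℝ[X]) = X - X^2 by ring, map_sub, a1, a2]
      norm_num
  | succ n ih =>
    obtain ⟨i1, i2, i3⟩ := ih
    obtain ⟨p1, p2⟩ := phi_psi n n le_rfl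
    have pp := psi_psi n n le_rfl
    rw [if_pos rfl] at pp
    rw [show n+1+1 = n+2 from rfl, phi1_succ, phi2_succ]
    set c := (2*(n:ℝ)+5)/(((n:ℝ)+1)*((n:ℝ)+2)*((n:ℝ)+3)*((n:ℝ)+4)) with hc
    have key : ∀ (A B P : ℝ[X]) (a b : ℝ), II ((A - C a * P) * (B - C b * P)) =
        II (A*B) - b * II (A*P) - a * II (B*P) + a * b * II (P*P) := by
      intro A B P a b
      rw [show (A - C a * P) * (B - C b * P) = A*B - C b * (A*P) - C a * (B*P)
        + C a * (C b * (P*P)) by ring, map_add, map_sub, map_sub, II_C_mul, II_C_mul, II_C_mul,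
        II_C_mul]
      ring
    have hs : ((-1:ℝ)^n) * (-1)^n = 1 := by rw [← mul_pow]; simp
    have h6 : (2:ℝ)*n+5 ≠ 0 := by positivity
    have hcc : c * (((n:ℝ)+1)*(n+2)*(n+3)*(n+4)/(2*n+5)) = 1 := by
      rw [hc]; field_simp
    have e1 : 1/(((n:ℝ)+1)*(n+3)) - c = 1/(((n:ℝ)+1+1)*(n+1+3)) := by
      rw [hc, show (n:ℝ)+1+1 = n+2 by ring, show (n:ℝ)+1+3 = n+4 by ring]; field_simp; ring
    have e2 : 1/(((n:ℝ)+1)*(n+2)*(n+3)) - c = -1/(((n:ℝ)+1+1)*(n+1+2)*(n+1+3)) := by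
      rw [hc, show (n:ℝ)+1+1 = n+2 by ring, show (n:ℝ)+1+2 = n+3 by ring,
        show (n:ℝ)+1+3 = n+4 by ring]; field_simp; ring
    push_cast
    refine ⟨?_, ?_, ?_⟩
    · rw [key, i1, p1, pp]
      linear_combination e1 + c * hcc
    · rw [key, i2, p2, pp]
      linear_combination e1 + c * hcc * ((-1:ℝ)^n * (-1)^n) - c * hs
    · rw [key, i3, p1, p2, pp]
      linear_combination (-1)^n * e2 + c * hcc * ((-1:ℝ)^n)

/-- Stability of the decomposition: ‖a₁φ₁*‖² + ‖a₂φ₂*‖² ≤ ((q+1)/q)‖a₁φ₁* + a₂φ₂*‖². -/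
theorem phiStar_stability (q : ℕ) (hq : 1 ≤ q) (a₁ a₂ : ℝ) :
    (∫ x in (0:ℝ)..1, (a₁ * (phiStar1 q).eval x)^2)
      + (∫ x in (0:ℝ)..1, (a₂ * (phiStar2 q).eval x)^2)
    ≤ (((q:ℝ)+1)/(q:ℝ))
        * ∫ x in (0:ℝ)..1, (a₁ * (phiStar1 q).eval x + a₂ * (phiStar2 q).eval x)^2 := by
  obtain ⟨n, rfl⟩ : ∃ n, q = n + 1 := ⟨q-1, by omega⟩
  obtain ⟨i1, i2, i3⟩ := gram n
  set P := phiStar1 (n+1)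
  set Q := phiStar2 (n+1)
  have t1 : (∫ x in (0:ℝ)..1, (a₁ * P.eval x)^2) = a₁^2 * II (P*P) := by
    rw [← II_C_mul, II_def]; congr 1; ext x; simp; ring
  have t2 : (∫ x in (0:ℝ)..1, (a₂ * Q.eval x)^2) = a₂^2 * II (Q*Q) := by
    rw [← II_C_mul, II_def]; congr 1; ext x; simp; ring
  have t3 : (∫ x in (0:ℝ)..1, (a₁ * P.eval x + a₂ * Q.eval x)^2)
      = a₁^2 * II (P*P) + 2*a₁*a₂ * II (P*Q) + a₂^2 * II (Q*Q) := by
    rw [← II_C_mul, ← II_C_mul, ← II_C_mul, ← map_add, ← map_add, II_def]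
    congr 1; ext x
    simp only [eval_add, eval_mul, eval_C]; ring
  rw [t1, t2, t3, i1, i2, i3]
  push_cast
  rw [← sub_nonneg]
  have e : ((n:ℝ)+1+1)/(n+1) * (a₁^2 * (1/(((n:ℝ)+1)*(n+3)))
      + 2*a₁*a₂ * ((-1)^n/(((n:ℝ)+1)*(n+2)*(n+3))) + a₂^2 * (1/(((n:ℝ)+1)*(n+3))))
      - (a₁^2 * (1/(((n:ℝ)+1)*(n+3))) + a₂^2 * (1/(((n:ℝ)+1)*(n+3))))
      = (a₁^2 + a₂^2 + 2*a₁*a₂*(-1)^n) / (((n:ℝ)+1)^2*(n+3)) := by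
    rw [show (n:ℝ)+1+1 = n+2 by ring]
    field_simp
    ring
  rw [e]
  apply div_nonneg _ (by positivity)
  rcases neg_one_pow_eq_or ℝ n with h | h <;> rw [h]
  · nlinarith [sq_nonneg (a₁ + a₂)]
  · nlinarith [sq_nonneg (a₁ - a₂)]
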